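/- arXiv:1906.02030 — 2 statements merged into one kernel-verified Lean document; each statement's English description precedes it below -/
import Mathlib

section
/- Under Assumptions 1 and 2, if all conditioning events have positive probability, P(U=c) > 0, r_D > 0, r_Y > 0, and r'_Z := P(Z=1|Z'=1) + P(Z=0|Z'=0) − 1 > 0, then CACE = CACE' × r_D / r_Y, where CACE = E(Y_1 − Y_0 | U=c) and CACE' = RD_{Y'|Z'} / RD_{D'|Z'}. -/
open MeasureTheory ProbabilityTheory

noncomputable def pr {Ω : Type*} [MeasurableSpace Ω] (μ : MeasureTheory.Measure Ω)
    (A : Set Ω) : ℝ := (μ A).toReal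

noncomputable def cpr {Ω : Type*} [MeasurableSpace Ω] (μ : MeasureTheory.Measure Ω)
    (B A : Set Ω) : ℝ := (ProbabilityTheory.cond μ B A).toReal

def bin01 : Set ℝ := {0, 1}

lemma measurableSet_eq_const {Ω : Type*} [MeasurableSpace Ω] {X : Ω → ℝ} (hX : Measurable X)
    (x : ℝ) : MeasurableSet {ω | X ω = x} :=
  hX (measurableSet_singleton x)

lemma cpr_mul_real {Ω : Type*} [MeasurableSpace Ω] (μ : Measure Ω) [IsFiniteMeasure μ]
    {B : Set Ω} (hB : MeasurableSet B) (A : Set Ω) :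
    cpr μ B A * μ.real B = μ.real (B ∩ A) := by
  have h := cond_mul_eq_inter hB A μ
  simp only [cpr, Measure.real]
  rw [← ENNReal.toReal_mul, h]

lemma real_add_of_binary {Ω : Type*} [MeasurableSpace Ω] (μ : Measure Ω) [IsFiniteMeasure μ]
    {X : Ω → ℝ} (hX : Measurable X) (hbin : ∀ ω, X ω = 0 ∨ X ω = 1) (B : Set Ω) :
    μ.real B = μ.real (B ∩ {ω | X ω = 0}) + μ.real (B ∩ {ω | X ω = 1}) := by
  rw [← measureReal_inter_add_sdiff (μ := μ) (s := B) (measurableSet_eq_const hX 0)]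
  congr 2
  ext ω
  rcases hbin ω with h | h <;> simp [h]

/-- A proportionality between two events survives summing over a binary variable. -/
lemma real_inter_eq_mul_of_binary {Ω : Type*} [MeasurableSpace Ω] (μ : Measure Ω)
    [IsFiniteMeasure μ] {X : Ω → ℝ} (hX : Measurable X) (hbin : ∀ ω, X ω = 0 ∨ X ω = 1)
    {A B : Set Ω} {c : ℝ}
    (h : ∀ x ∈ bin01, μ.real ((B ∩ {ω | X ω = x}) ∩ A) = c * μ.real (B ∩ {ω | X ω = x})) :
    μ.real (B ∩ A) = c * μ.real B := by
  rw [real_add_of_binary μ hX hbin (B ∩ A), real_add_of_binary μ hX hbin B, mul_add,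
    ← h 0 (by simp [bin01]), ← h 1 (by simp [bin01]), Set.inter_right_comm, Set.inter_right_comm B A]

/-- If `T` is independent of `S` given the binary variable `W`, risk differences multiply. -/
lemma risk_difference_mul {Ω : Type*} [MeasurableSpace Ω] (μ : Measure Ω) [IsFiniteMeasure μ]
    {T W S : Ω → ℝ} (hW : Measurable W) (hS : Measurable S) (hbin : ∀ ω, W ω = 0 ∨ W ω = 1)
    (hpos : ∀ s ∈ bin01, μ.real {ω | S ω = s} ≠ 0)
    (h : ∀ w ∈ bin01, ∀ s ∈ bin01, μ.real ({ω | W ω = w} ∩ {ω | S ω = s} ∩ {ω | T ω = 1})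
      = cpr μ {ω | W ω = w} {ω | T ω = 1} * μ.real ({ω | W ω = w} ∩ {ω | S ω = s})) :
    cpr μ {ω | S ω = 1} {ω | T ω = 1} - cpr μ {ω | S ω = 0} {ω | T ω = 1}
      = (cpr μ {ω | W ω = 1} {ω | T ω = 1} - cpr μ {ω | W ω = 0} {ω | T ω = 1})
        * (cpr μ {ω | S ω = 1} {ω | W ω = 1} - cpr μ {ω | S ω = 0} {ω | W ω = 1}) := by
  have key : ∀ s ∈ bin01, cpr μ {ω | S ω = s} {ω | T ω = 1}
      = cpr μ {ω | W ω = 0} {ω | T ω = 1} + (cpr μ {ω | W ω = 1} {ω | T ω = 1}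
        - cpr μ {ω | W ω = 0} {ω | T ω = 1}) * cpr μ {ω | S ω = s} {ω | W ω = 1} := by
    intro s hs
    apply mul_right_cancel₀ (hpos s hs)
    have hSs := measurableSet_eq_const hS s
    have e1 := cpr_mul_real μ hSs {ω | T ω = 1}
    have e2 := cpr_mul_real μ hSs {ω | W ω = 1}
    have e3 := real_add_of_binary μ hW hbin {ω | S ω = s}
    have e4 := real_add_of_binary μ hW hbin ({ω | S ω = s} ∩ {ω | T ω = 1})
    have h0 := h 0 (by simp [bin01]) s hs
    have h1 := h 1 (by simp [bin01]) s hs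
    rw [Set.inter_comm {ω | W ω = _}, Set.inter_right_comm] at h0 h1
    rw [e1, add_mul, mul_assoc, e2, e4, h0, h1, e3]
    ring
  rw [key 1 (by simp [bin01]), key 0 (by simp [bin01])]
  ring

lemma cpr_zero_eq_one_sub {Ω : Type*} [MeasurableSpace Ω] (μ : Measure Ω) [IsFiniteMeasure μ]
    {X : Ω → ℝ} (hX : Measurable X) (hbin : ∀ ω, X ω = 0 ∨ X ω = 1) {B : Set Ω}
    (hB : MeasurableSet B) (hpos : μ.real B ≠ 0) :
    cpr μ B {ω | X ω = 0} = 1 - cpr μ B {ω | X ω = 1} := by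
  apply mul_right_cancel₀ hpos
  rw [sub_mul, cpr_mul_real μ hB, cpr_mul_real μ hB, one_mul]
  linarith [real_add_of_binary μ hX hbin B]

/-- Conditional independence given `{W = w}` is symmetric in the two remaining events. -/
lemma real_inter_eq_cpr_mul_symm {Ω : Type*} [MeasurableSpace Ω] (μ : Measure Ω)
    [IsFiniteMeasure μ] {A B C : Set Ω} (hB : MeasurableSet B)
    (h : μ.real (B ∩ C ∩ A) = cpr μ B A * μ.real (B ∩ C)) :
    μ.real (B ∩ A ∩ C) = cpr μ B C * μ.real (B ∩ A) := by
  rw [Set.inter_right_comm, h, ← cpr_mul_real μ hB C, ← cpr_mul_real μ hB A]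
  ring

lemma integral_eq_real_of_binary {Ω : Type*} [MeasurableSpace Ω] (μ : Measure Ω)
    [IsFiniteMeasure μ] {X : Ω → ℝ} (hX : Measurable X) (hbin : ∀ ω, X ω = 0 ∨ X ω = 1) :
    Integrable X μ ∧ ∫ ω, X ω ∂μ = μ.real {ω | X ω = 1} := by
  have hm := measurableSet_eq_const hX 1
  have e : X = Set.indicator {ω | X ω = 1} 1 := by
    ext ω
    rcases hbin ω with h | h <;> simp [Set.indicator, h]
  constructor
  · rw [e]
    exact (integrable_const (1 : ℝ)).indicator hm
  · conv_lhs => rw [e]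
    exact integral_indicator_one hm

/-- The observed variable at `Z = z` agrees with a potential variable independent of `Z`. -/
lemma cpr_eq_real_of_indep {Ω : Type*} [MeasurableSpace Ω] (μ : Measure Ω) [IsFiniteMeasure μ]
    {Z X V : Ω → ℝ} (hZ : Measurable Z) {z : ℝ} (hpos : μ.real {ω | Z ω = z} ≠ 0)
    (hind : IndepFun Z V μ) (hX : ∀ ω, Z ω = z → X ω = V ω) :
    cpr μ {ω | Z ω = z} {ω | X ω = 1} = μ.real {ω | V ω = 1} := by
  apply mul_right_cancel₀ hpos
  rw [cpr_mul_real μ (measurableSet_eq_const hZ z)]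
  have e : {ω | Z ω = z} ∩ {ω | X ω = 1} = Z ⁻¹' {z} ∩ V ⁻¹' {1} := by
    ext ω
    simp only [Set.mem_inter_iff, Set.mem_ofPred_eq, Set.mem_preimage, Set.mem_singleton_iff]
    exact and_congr_right fun h => by rw [hX ω h]
  have := hind.measure_inter_preimage_eq_mul {z} {1} (measurableSet_singleton _)
    (measurableSet_singleton _)
  rw [e, Measure.real, this, ENNReal.toReal_mul, mul_comm]
  rfl

/-- Splitting an event over the principal strata when there are no defiers. -/
lemma real_eq_add_strata {Ω : Type*} [MeasurableSpace Ω] (μ : Measure Ω) [IsFiniteMeasure μ]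
    {D1 D0 : Ω → ℝ} (h1 : Measurable D1) (h0 : Measurable D0)
    (hb1 : ∀ ω, D1 ω = 0 ∨ D1 ω = 1) (hb0 : ∀ ω, D0 ω = 0 ∨ D0 ω = 1)
    (hmono : ∀ᵐ ω ∂μ, D0 ω ≤ D1 ω) (A : Set Ω) :
    μ.real A = μ.real ({ω | D1 ω = 1 ∧ D0 ω = 1} ∩ A) + μ.real ({ω | D1 ω = 0 ∧ D0 ω = 0} ∩ A)
      + μ.real ({ω | D1 ω = 1 ∧ D0 ω = 0} ∩ A) := by
  have key : ∀ a b : ℝ, A ∩ {ω | D1 ω = a} ∩ {ω | D0 ω = b}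
      = {ω | D1 ω = a ∧ D0 ω = b} ∩ A := by
    intro a b
    ext ω
    simp only [Set.mem_inter_iff, Set.mem_ofPred_eq]
    tauto
  have hd : μ.real ({ω | D1 ω = 0 ∧ D0 ω = 1} ∩ A) = 0 := by
    have : μ ({ω | D1 ω = 0 ∧ D0 ω = 1} ∩ A) = 0 := by
      refine measure_mono_null ?_ (ae_iff.mp hmono)
      rintro ω ⟨⟨ha, hb⟩, -⟩
      simp [ha, hb]
    simp [Measure.real, this]
  rw [real_add_of_binary μ h1 hb1 A, real_add_of_binary μ h0 hb0 (A ∩ {ω | D1 ω = 0}),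
    real_add_of_binary μ h0 hb0 (A ∩ {ω | D1 ω = 1}), key, key, key, key, hd]
  ring

set_option maxHeartbeats 1000000 in
theorem stmt3 {Ω : Type*} [MeasurableSpace Ω]
    (μ : MeasureTheory.Measure Ω) [IsProbabilityMeasure μ]
    (Z D Y Z' D' Y' D1 D0 Y1 Y0 : Ω → ℝ)
    (h_meas_Z : Measurable Z)
    (h_meas_D : Measurable D)
    (h_meas_Y : Measurable Y)
    (h_meas_Zp : Measurable Z')
    (h_meas_Dp : Measurable D')
    (h_meas_Yp : Measurable Y')
    (h_meas_D1 : Measurable D1)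
    (h_meas_D0 : Measurable D0)
    (h_meas_Y1 : Measurable Y1)
    (h_meas_Y0 : Measurable Y0)
    (h_bin_Z : ∀ ω, Z ω = 0 ∨ Z ω = 1)
    (h_bin_Zp : ∀ ω, Z' ω = 0 ∨ Z' ω = 1)
    (h_bin_Dp : ∀ ω, D' ω = 0 ∨ D' ω = 1)
    (h_bin_Yp : ∀ ω, Y' ω = 0 ∨ Y' ω = 1)
    (h_bin_D1 : ∀ ω, D1 ω = 0 ∨ D1 ω = 1)
    (h_bin_D0 : ∀ ω, D0 ω = 0 ∨ D0 ω = 1)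
    (h_bin_Y1 : ∀ ω, Y1 ω = 0 ∨ Y1 ω = 1)
    (h_bin_Y0 : ∀ ω, Y0 ω = 0 ∨ Y0 ω = 1)
    (h_consD : ∀ ω, D ω = Z ω * D1 ω + (1 - Z ω) * D0 ω)
    (h_consY : ∀ ω, Y ω = Z ω * Y1 ω + (1 - Z ω) * Y0 ω)
    (h_indep : IndepFun Z (fun ω => (Y1 ω, Y0 ω, D1 ω, D0 ω)) μ)
    (h_mono : ∀ᵐ ω ∂μ, D0 ω ≤ D1 ω)
    (h_exclA : cpr μ {ω | D1 ω = 1 ∧ D0 ω = 1} {ω | Y1 ω = 1}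
        = cpr μ {ω | D1 ω = 1 ∧ D0 ω = 1} {ω | Y0 ω = 1})
    (h_exclN : cpr μ {ω | D1 ω = 0 ∧ D0 ω = 0} {ω | Y1 ω = 1}
        = cpr μ {ω | D1 ω = 0 ∧ D0 ω = 0} {ω | Y0 ω = 1})
    (h_ndD : ∀ d ∈ bin01, ∀ d' ∈ bin01, ∀ z ∈ bin01, ∀ z' ∈ bin01, ∀ y ∈ bin01, ∀ y' ∈ bin01,
      cpr μ ({ω | D ω = d} ∩ {ω | Z' ω = z'} ∩ {ω | Z ω = z} ∩ {ω | Y ω = y} ∩ {ω | Y' ω = y'}) {ω | D' ω = d'}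
        = cpr μ {ω | D ω = d} {ω | D' ω = d'})
    (h_ndY : ∀ y ∈ bin01, ∀ y' ∈ bin01, ∀ z ∈ bin01, ∀ z' ∈ bin01, ∀ d ∈ bin01, ∀ d' ∈ bin01,
      cpr μ ({ω | Y ω = y} ∩ {ω | Z ω = z} ∩ {ω | Z' ω = z'} ∩ {ω | D ω = d} ∩ {ω | D' ω = d'}) {ω | Y' ω = y'}
        = cpr μ {ω | Y ω = y} {ω | Y' ω = y'})
    (h_ndZ : ∀ z ∈ bin01, ∀ z' ∈ bin01, ∀ y ∈ bin01, ∀ y' ∈ bin01, ∀ d ∈ bin01, ∀ d' ∈ bin01,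
      cpr μ ({ω | Z ω = z} ∩ {ω | Y ω = y} ∩ {ω | Y' ω = y'} ∩ {ω | D ω = d} ∩ {ω | D' ω = d'}) {ω | Z' ω = z'}
        = cpr μ {ω | Z ω = z} {ω | Z' ω = z'})
    (h_pos : ∀ z ∈ bin01, ∀ z' ∈ bin01, ∀ d ∈ bin01, ∀ d' ∈ bin01, ∀ y ∈ bin01, ∀ y' ∈ bin01,
      μ ({ω | D ω = d} ∩ {ω | Z' ω = z'} ∩ {ω | Z ω = z} ∩ {ω | Y ω = y} ∩ {ω | Y' ω = y'}) ≠ 0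
      ∧ μ ({ω | Y ω = y} ∩ {ω | Z ω = z} ∩ {ω | Z' ω = z'} ∩ {ω | D ω = d} ∩ {ω | D' ω = d'}) ≠ 0
      ∧ μ ({ω | Z ω = z} ∩ {ω | Y ω = y} ∩ {ω | Y' ω = y'} ∩ {ω | D ω = d} ∩ {ω | D' ω = d'}) ≠ 0)
    (h_Uc : 0 < pr μ {ω | D1 ω = 1 ∧ D0 ω = 0})
    (SND SPD SNY SPY : ℝ)
    (h_SND : SND = cpr μ {ω | D ω = 1} {ω | D' ω = 1})
    (h_SPD : SPD = cpr μ {ω | D ω = 0} {ω | D' ω = 0})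
    (h_SNY : SNY = cpr μ {ω | Y ω = 1} {ω | Y' ω = 1})
    (h_SPY : SPY = cpr μ {ω | Y ω = 0} {ω | Y' ω = 0})
    (h_rD : 0 < SND + SPD - 1) (h_rY : 0 < SNY + SPY - 1)
    (h_rZ : 0 < cpr μ {ω | Z' ω = 1} {ω | Z ω = 1}
          + cpr μ {ω | Z' ω = 0} {ω | Z ω = 0} - 1) :
    ∫ ω, (Y1 ω - Y0 ω) ∂(ProbabilityTheory.cond μ {ω | D1 ω = 1 ∧ D0 ω = 0})
      = (cpr μ {ω | Z' ω = 1} {ω | Y' ω = 1} - cpr μ {ω | Z' ω = 0} {ω | Y' ω = 1})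
          / (cpr μ {ω | Z' ω = 1} {ω | D' ω = 1} - cpr μ {ω | Z' ω = 0} {ω | D' ω = 1})
        * (SND + SPD - 1) / (SNY + SPY - 1) := by
  have hbD : ∀ ω, D ω = 0 ∨ D ω = 1 := by
    intro ω
    rw [h_consD]
    rcases h_bin_Z ω with h | h <;> simp [h, h_bin_D1 ω, h_bin_D0 ω]
  have hbY : ∀ ω, Y ω = 0 ∨ Y ω = 1 := by
    intro ω
    rw [h_consY]
    rcases h_bin_Z ω with h | h <;> simp [h, h_bin_Y1 ω, h_bin_Y0 ω]
  have m0 : (0 : ℝ) ∈ bin01 := by simp [bin01]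
  have m1 : (1 : ℝ) ∈ bin01 := by simp [bin01]
  have mZ := measurableSet_eq_const h_meas_Z
  have mD := measurableSet_eq_const h_meas_D
  have mY := measurableSet_eq_const h_meas_Y
  have mZ' := measurableSet_eq_const h_meas_Zp
  have mD' := measurableSet_eq_const h_meas_Dp
  have mY' := measurableSet_eq_const h_meas_Yp
  have pos_of : ∀ {A B : Set Ω}, μ A ≠ 0 → A ⊆ B → μ.real B ≠ 0 := by
    intro A B hA hAB hB
    rw [measureReal_eq_zero_iff] at hB
    exact hA (measure_mono_null hAB hB)
  have pZ : ∀ z ∈ bin01, μ.real {ω | Z ω = z} ≠ 0 := fun z hz =>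
    pos_of (h_pos z hz 0 m0 0 m0 0 m0 0 m0 0 m0).1 fun ω hω => hω.1.1.2
  have pZ' : ∀ z ∈ bin01, μ.real {ω | Z' ω = z} ≠ 0 := fun z hz =>
    pos_of (h_pos 0 m0 z hz 0 m0 0 m0 0 m0 0 m0).1 fun ω hω => hω.1.1.1.2
  have pD : ∀ z ∈ bin01, μ.real {ω | D ω = z} ≠ 0 := fun z hz =>
    pos_of (h_pos 0 m0 0 m0 z hz 0 m0 0 m0 0 m0).1 fun ω hω => hω.1.1.1.1
  have pY : ∀ z ∈ bin01, μ.real {ω | Y ω = z} ≠ 0 := fun z hz =>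
    pos_of (h_pos 0 m0 0 m0 0 m0 0 m0 z hz 0 m0).1 fun ω hω => hω.1.2
  have ciD : ∀ d ∈ bin01, ∀ z' ∈ bin01,
      μ.real ({ω | D ω = d} ∩ {ω | Z' ω = z'} ∩ {ω | D' ω = 1})
        = cpr μ {ω | D ω = d} {ω | D' ω = 1} * μ.real ({ω | D ω = d} ∩ {ω | Z' ω = z'}) := by
    intro d hd z' hz'
    refine real_inter_eq_mul_of_binary μ h_meas_Z h_bin_Z fun z hz => ?_
    refine real_inter_eq_mul_of_binary μ h_meas_Y hbY fun y hy => ?_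
    refine real_inter_eq_mul_of_binary μ h_meas_Yp h_bin_Yp fun y' hy' => ?_
    rw [← h_ndD d hd 1 m1 z hz z' hz' y hy y' hy', cpr_mul_real]
    exact ((((mD d).inter (mZ' z')).inter (mZ z)).inter (mY y)).inter (mY' y')
  have ciY : ∀ y ∈ bin01, ∀ z' ∈ bin01,
      μ.real ({ω | Y ω = y} ∩ {ω | Z' ω = z'} ∩ {ω | Y' ω = 1})
        = cpr μ {ω | Y ω = y} {ω | Y' ω = 1} * μ.real ({ω | Y ω = y} ∩ {ω | Z' ω = z'}) := by
    intro y hy z' hz'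
    refine real_inter_eq_mul_of_binary μ h_meas_Z h_bin_Z fun z hz => ?_
    rw [Set.inter_right_comm {ω | Y ω = y}]
    refine real_inter_eq_mul_of_binary μ h_meas_D hbD fun d hd => ?_
    refine real_inter_eq_mul_of_binary μ h_meas_Dp h_bin_Dp fun d' hd' => ?_
    rw [← h_ndY y hy 1 m1 z hz z' hz' d hd d' hd', cpr_mul_real]
    exact ((((mY y).inter (mZ z)).inter (mZ' z')).inter (mD d)).inter (mD' d')
  have ciZY : ∀ z ∈ bin01, ∀ z' ∈ bin01,
      μ.real ({ω | Z ω = z} ∩ {ω | Z' ω = z'} ∩ {ω | Y ω = 1})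
        = cpr μ {ω | Z ω = z} {ω | Y ω = 1} * μ.real ({ω | Z ω = z} ∩ {ω | Z' ω = z'}) := by
    intro z hz z' hz'
    refine real_inter_eq_cpr_mul_symm μ (mZ z) ?_
    refine real_inter_eq_mul_of_binary μ h_meas_Yp h_bin_Yp fun y' hy' => ?_
    refine real_inter_eq_mul_of_binary μ h_meas_D hbD fun d hd => ?_
    refine real_inter_eq_mul_of_binary μ h_meas_Dp h_bin_Dp fun d' hd' => ?_
    rw [← h_ndZ z hz z' hz' 1 m1 y' hy' d hd d' hd', cpr_mul_real]
    exact ((((mZ z).inter (mY 1)).inter (mY' y')).inter (mD d)).inter (mD' d')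
  have ciZD : ∀ z ∈ bin01, ∀ z' ∈ bin01,
      μ.real ({ω | Z ω = z} ∩ {ω | Z' ω = z'} ∩ {ω | D ω = 1})
        = cpr μ {ω | Z ω = z} {ω | D ω = 1} * μ.real ({ω | Z ω = z} ∩ {ω | Z' ω = z'}) := by
    intro z hz z' hz'
    refine real_inter_eq_cpr_mul_symm μ (mZ z) ?_
    refine real_inter_eq_mul_of_binary μ h_meas_Y hbY fun y hy => ?_
    rw [Set.inter_right_comm {ω | Z ω = z}]
    refine real_inter_eq_mul_of_binary μ h_meas_Yp h_bin_Yp fun y' hy' => ?_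
    rw [Set.inter_right_comm ({ω | Z ω = z} ∩ {ω | Y ω = y})]
    refine real_inter_eq_mul_of_binary μ h_meas_Dp h_bin_Dp fun d' hd' => ?_
    rw [← h_ndZ z hz z' hz' y hy y' hy' 1 m1 d' hd', cpr_mul_real]
    exact ((((mZ z).inter (mY y)).inter (mY' y')).inter (mD 1)).inter (mD' d')
  have rdY := risk_difference_mul μ h_meas_Y h_meas_Zp hbY pZ' ciY
  have rdD := risk_difference_mul μ h_meas_D h_meas_Zp hbD pZ' ciD
  have rdZY := risk_difference_mul μ h_meas_Z h_meas_Zp h_bin_Z pZ' ciZY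
  have rdZD := risk_difference_mul μ h_meas_Z h_meas_Zp h_bin_Z pZ' ciZD
  rw [cpr_zero_eq_one_sub μ h_meas_Dp h_bin_Dp (mD 0) (pD 0 m0)] at h_SPD
  rw [cpr_zero_eq_one_sub μ h_meas_Yp h_bin_Yp (mY 0) (pY 0 m0)] at h_SPY
  rw [cpr_zero_eq_one_sub μ h_meas_Z h_bin_Z (mZ' 0) (pZ' 0 m0)] at h_rZ
  have vY1 := cpr_eq_real_of_indep (X := Y) (V := Y1) μ h_meas_Z (pZ 1 m1)
    (h_indep.comp measurable_id measurable_fst) fun ω h => by simp [h_consY, h]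
  have vY0 := cpr_eq_real_of_indep (X := Y) (V := Y0) μ h_meas_Z (pZ 0 m0)
    (h_indep.comp measurable_id measurable_snd.fst) fun ω h => by simp [h_consY, h]
  have vD1 := cpr_eq_real_of_indep (X := D) (V := D1) μ h_meas_Z (pZ 1 m1)
    (h_indep.comp measurable_id measurable_snd.snd.fst) fun ω h => by simp [h_consD, h]
  have vD0 := cpr_eq_real_of_indep (X := D) (V := D0) μ h_meas_Z (pZ 0 m0)
    (h_indep.comp measurable_id measurable_snd.snd.snd) fun ω h => by simp [h_consD, h]
  have mS : ∀ a b : ℝ, MeasurableSet {ω | D1 ω = a ∧ D0 ω = b} := fun a b =>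
    (measurableSet_eq_const h_meas_D1 a).inter (measurableSet_eq_const h_meas_D0 b)
  have strata := real_eq_add_strata μ h_meas_D1 h_meas_D0 h_bin_D1 h_bin_D0 h_mono
  have effY : μ.real {ω | Y1 ω = 1} - μ.real {ω | Y0 ω = 1}
      = (cpr μ {ω | D1 ω = 1 ∧ D0 ω = 0} {ω | Y1 ω = 1}
        - cpr μ {ω | D1 ω = 1 ∧ D0 ω = 0} {ω | Y0 ω = 1})
          * μ.real {ω | D1 ω = 1 ∧ D0 ω = 0} := by
    rw [strata {ω | Y1 ω = 1}, strata {ω | Y0 ω = 1}]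
    simp only [← cpr_mul_real μ (mS _ _), h_exclA, h_exclN]
    ring
  have effD : μ.real {ω | D1 ω = 1} - μ.real {ω | D0 ω = 1}
      = μ.real {ω | D1 ω = 1 ∧ D0 ω = 0} := by
    have e1 : {ω | D1 ω = 1 ∧ D0 ω = 1} ∩ {ω | D1 ω = 1} = {ω | D1 ω = 1 ∧ D0 ω = 1} :=
      Set.inter_eq_left.mpr fun ω h => h.1
    have e2 : {ω | D1 ω = 1 ∧ D0 ω = 0} ∩ {ω | D1 ω = 1} = {ω | D1 ω = 1 ∧ D0 ω = 0} :=
      Set.inter_eq_left.mpr fun ω h => h.1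
    have e3 : {ω | D1 ω = 0 ∧ D0 ω = 0} ∩ {ω | D1 ω = 1} = ∅ := by
      ext ω
      simp +contextual
    have e4 : {ω | D1 ω = 1 ∧ D0 ω = 1} ∩ {ω | D0 ω = 1} = {ω | D1 ω = 1 ∧ D0 ω = 1} :=
      Set.inter_eq_left.mpr fun ω h => h.2
    have e5 : ∀ a : ℝ, {ω | D1 ω = a ∧ D0 ω = 0} ∩ {ω | D0 ω = 1} = ∅ := by
      intro a
      ext ω
      simp +contextual
    rw [strata {ω | D1 ω = 1}, strata {ω | D0 ω = 1}, e1, e2, e3, e4, e5, e5]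
    simp
  have cace : ∫ ω, (Y1 ω - Y0 ω) ∂(ProbabilityTheory.cond μ {ω | D1 ω = 1 ∧ D0 ω = 0})
      = cpr μ {ω | D1 ω = 1 ∧ D0 ω = 0} {ω | Y1 ω = 1}
        - cpr μ {ω | D1 ω = 1 ∧ D0 ω = 0} {ω | Y0 ω = 1} := by
    obtain ⟨i1, j1⟩ := integral_eq_real_of_binary μ[|{ω | D1 ω = 1 ∧ D0 ω = 0}]
      h_meas_Y1 h_bin_Y1
    obtain ⟨i0, j0⟩ := integral_eq_real_of_binary μ[|{ω | D1 ω = 1 ∧ D0 ω = 0}]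
      h_meas_Y0 h_bin_Y0
    rw [integral_sub i1 i0, j1, j0]
    rfl
  have hc : 0 < μ.real {ω | D1 ω = 1 ∧ D0 ω = 0} := h_Uc
  rw [vY1, vY0, effY] at rdZY
  rw [vD1, vD0, effD] at rdZD
  rw [rdZY] at rdY
  rw [rdZD] at rdD
  rw [cace, rdY, rdD]
  have hrD : SND + SPD - 1
      = cpr μ {ω | D ω = 1} {ω | D' ω = 1} - cpr μ {ω | D ω = 0} {ω | D' ω = 1} := by
    rw [h_SND, h_SPD]
    ring
  have hrY : SNY + SPY - 1
      = cpr μ {ω | Y ω = 1} {ω | Y' ω = 1} - cpr μ {ω | Y ω = 0} {ω | Y' ω = 1} := by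
    rw [h_SNY, h_SPY]
    ring
  have hrZ : 0 < cpr μ {ω | Z' ω = 1} {ω | Z ω = 1} - cpr μ {ω | Z' ω = 0} {ω | Z ω = 1} := by
    linarith
  rw [← hrD, ← hrY]
  have nD := h_rD.ne'
  have nY := h_rY.ne'
  have nZ := hrZ.ne'
  have nc := hc.ne'
  generalize SND + SPD - 1 = rD at *
  generalize SNY + SPY - 1 = rY at *
  generalize cpr μ {ω | Z' ω = 1} {ω | Z ω = 1} - cpr μ {ω | Z' ω = 0} {ω | Z ω = 1} = rZ at *
  field_simp
end

section
/- Suppose Assumption 1 holds, only Y is mismeasured (Z'=Z and D'=D almost surely), the measurement error of Y is non-differential with respect to the potential values (Y' is independent of (Z, D_1, D_0, Y_1, Y_0) given Y), all conditioning events have positive probability, P(U=u) > 0 for u=a,n,c, and r_Y ≠ 0. Then: P(Y_1=1|U=n) = P(Y_0=1|U=n) = [P(Y'=1|D=0,Z=1) − (1−SP_Y)] / r_Y; P(Y_1=1|U=a) = P(Y_0=1|U=a) = [P(Y'=1|D=1,Z=0) − (1−SP_Y)] / r_Y; P(Y_1=1|U=c) = [RD_{Y'D|Z}/RD_{D|Z}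 − (1−SP_Y)] / r_Y; and P(Y_0=1|U=c) = [RD_{Y'(1−D)|(1−Z)}/RD_{D|Z} − (1−SP_Y)] / r_Y. -/
open MeasureTheory ProbabilityTheory

theorem cpr_eq_div {Ω : Type*} [MeasurableSpace Ω] (μ : Measure Ω) {B : Set Ω}
    (hB : MeasurableSet B) (A : Set Ω) : cpr μ B A = μ.real (B ∩ A) / μ.real B := by
  rw [cpr, cond_apply hB, ENNReal.toReal_mul, ENNReal.toReal_inv, div_eq_inv_mul]
  rfl

theorem measureReal_eq_add_of_binary {Ω : Type*} [MeasurableSpace Ω] (μ : Measure Ω)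
    [IsFiniteMeasure μ] {X : Ω → ℝ} (hX : Measurable X) (hbin : ∀ ω, X ω = 0 ∨ X ω = 1)
    (A : Set Ω) : μ.real A = μ.real (A ∩ {ω | X ω = 0}) + μ.real (A ∩ {ω | X ω = 1}) := by
  rw [← measureReal_inter_add_sdiff (μ := μ) (s := A) (hX (measurableSet_singleton (0 : ℝ)))]
  congr 2
  ext ω
  rcases hbin ω with h | h <;> simp [h]

set_option maxHeartbeats 1000000 in
theorem stmt4 {Ω : Type*} [MeasurableSpace Ω]
    (μ : MeasureTheory.Measure Ω) [IsProbabilityMeasure μ]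
    (Z D Y Y' D1 D0 Y1 Y0 : Ω → ℝ)
    (h_meas_Z : Measurable Z)
    (h_meas_D : Measurable D)
    (h_meas_Y : Measurable Y)
    (h_meas_Yp : Measurable Y')
    (h_meas_D1 : Measurable D1)
    (h_meas_D0 : Measurable D0)
    (h_meas_Y1 : Measurable Y1)
    (h_meas_Y0 : Measurable Y0)
    (h_bin_Z : ∀ ω, Z ω = 0 ∨ Z ω = 1)
    (h_bin_Yp : ∀ ω, Y' ω = 0 ∨ Y' ω = 1)
    (h_bin_D1 : ∀ ω, D1 ω = 0 ∨ D1 ω = 1)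
    (h_bin_D0 : ∀ ω, D0 ω = 0 ∨ D0 ω = 1)
    (h_bin_Y1 : ∀ ω, Y1 ω = 0 ∨ Y1 ω = 1)
    (h_bin_Y0 : ∀ ω, Y0 ω = 0 ∨ Y0 ω = 1)
    (h_consD : ∀ ω, D ω = Z ω * D1 ω + (1 - Z ω) * D0 ω)
    (h_consY : ∀ ω, Y ω = Z ω * Y1 ω + (1 - Z ω) * Y0 ω)
    (h_indep : IndepFun Z (fun ω => (Y1 ω, Y0 ω, D1 ω, D0 ω)) μ)
    (h_mono : ∀ᵐ ω ∂μ, D0 ω ≤ D1 ω)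
    (h_exclA : cpr μ {ω | D1 ω = 1 ∧ D0 ω = 1} {ω | Y1 ω = 1}
        = cpr μ {ω | D1 ω = 1 ∧ D0 ω = 1} {ω | Y0 ω = 1})
    (h_exclN : cpr μ {ω | D1 ω = 0 ∧ D0 ω = 0} {ω | Y1 ω = 1}
        = cpr μ {ω | D1 ω = 0 ∧ D0 ω = 0} {ω | Y0 ω = 1})
    (h_ndY : ∀ y ∈ bin01, ∀ y' ∈ bin01, ∀ z ∈ bin01, ∀ d1 ∈ bin01, ∀ d0 ∈ bin01, ∀ y1 ∈ bin01, ∀ y0 ∈ bin01,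
      μ ({ω | Y ω = y} ∩ {ω | Z ω = z} ∩ {ω | D1 ω = d1} ∩ {ω | D0 ω = d0} ∩ {ω | Y1 ω = y1} ∩ {ω | Y0 ω = y0}) ≠ 0 →
      cpr μ ({ω | Y ω = y} ∩ {ω | Z ω = z} ∩ {ω | D1 ω = d1} ∩ {ω | D0 ω = d0} ∩ {ω | Y1 ω = y1} ∩ {ω | Y0 ω = y0}) {ω | Y' ω = y'}
        = cpr μ {ω | Y ω = y} {ω | Y' ω = y'})
    (h_posDZ : ∀ d ∈ bin01, ∀ z ∈ bin01,
      μ ({ω | D ω = d} ∩ {ω | Z ω = z}) ≠ 0)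
    (h_posY : ∀ y ∈ bin01, μ {ω | Y ω = y} ≠ 0)
    (h_Ua : 0 < pr μ {ω | D1 ω = 1 ∧ D0 ω = 1})
    (h_Un : 0 < pr μ {ω | D1 ω = 0 ∧ D0 ω = 0})
    (h_Uc : 0 < pr μ {ω | D1 ω = 1 ∧ D0 ω = 0})
    (SNY SPY : ℝ)
    (h_SNY : SNY = cpr μ {ω | Y ω = 1} {ω | Y' ω = 1})
    (h_SPY : SPY = cpr μ {ω | Y ω = 0} {ω | Y' ω = 0})
    (h_rY : SNY + SPY - 1 ≠ 0)
    (RDD : ℝ)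
    (h_RDD : RDD = (cpr μ {ω | Z ω = 1} {ω | D ω = 1} - cpr μ {ω | Z ω = 0} {ω | D ω = 1})) :
    cpr μ {ω | D1 ω = 0 ∧ D0 ω = 0} {ω | Y1 ω = 1}
      = (cpr μ ({ω | D ω = 0} ∩ {ω | Z ω = 1}) {ω | Y' ω = 1} - (1 - SPY)) / (SNY + SPY - 1)
    ∧ cpr μ {ω | D1 ω = 0 ∧ D0 ω = 0} {ω | Y0 ω = 1}
      = (cpr μ ({ω | D ω = 0} ∩ {ω | Z ω = 1}) {ω | Y' ω = 1} - (1 - SPY)) / (SNY + SPY - 1)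
    ∧ cpr μ {ω | D1 ω = 1 ∧ D0 ω = 1} {ω | Y1 ω = 1}
      = (cpr μ ({ω | D ω = 1} ∩ {ω | Z ω = 0}) {ω | Y' ω = 1} - (1 - SPY)) / (SNY + SPY - 1)
    ∧ cpr μ {ω | D1 ω = 1 ∧ D0 ω = 1} {ω | Y0 ω = 1}
      = (cpr μ ({ω | D ω = 1} ∩ {ω | Z ω = 0}) {ω | Y' ω = 1} - (1 - SPY)) / (SNY + SPY - 1)
    ∧ cpr μ {ω | D1 ω = 1 ∧ D0 ω = 0} {ω | Y1 ω = 1}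
      = ((cpr μ {ω | Z ω = 1} ({ω | Y' ω = 1} ∩ {ω | D ω = 1}) - cpr μ {ω | Z ω = 0} ({ω | Y' ω = 1} ∩ {ω | D ω = 1})) / RDD - (1 - SPY)) / (SNY + SPY - 1)
    ∧ cpr μ {ω | D1 ω = 1 ∧ D0 ω = 0} {ω | Y0 ω = 1}
      = ((cpr μ {ω | Z ω = 0} ({ω | Y' ω = 1} ∩ {ω | D ω = 0}) - cpr μ {ω | Z ω = 1} ({ω | Y' ω = 1} ∩ {ω | D ω = 0})) / RDD - (1 - SPY)) / (SNY + SPY - 1) := by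
  have split {X : Ω → ℝ} (hX : Measurable X) (hbin : ∀ ω, X ω = 0 ∨ X ω = 1) (A : Set Ω) :=
    measureReal_eq_add_of_binary μ hX hbin A
  have level {X : Ω → ℝ} (hX : Measurable X) (x : ℝ) : MeasurableSet {ω | X ω = x} :=
    hX (measurableSet_singleton x)
  have zero_mem : (0 : ℝ) ∈ bin01 := by simp [bin01]
  have one_mem : (1 : ℝ) ∈ bin01 := by simp [bin01]
  set S : ℝ → ℝ → Set Ω := fun d1 d0 => {ω | D1 ω = d1 ∧ D0 ω = d0} with hS
  have stratum_measurable (d1 d0 : ℝ) : MeasurableSet (S d1 d0) :=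
    (level h_meas_D1 d1).inter (level h_meas_D0 d0)
  have hq0 : cpr μ {ω | Y ω = 0} {ω | Y' ω = 1} = 1 - SPY := by
    have hpos : μ.real {ω | Y ω = 0} ≠ 0 := by
      simpa [measureReal_eq_zero_iff] using h_posY 0 zero_mem
    have := split h_meas_Yp h_bin_Yp {ω | Y ω = 0}
    rw [h_SPY, cpr_eq_div μ (level h_meas_Y 0), cpr_eq_div μ (level h_meas_Y 0)]
    field_simp
    linarith
  have cell (z d1 d0 y1 y0 : ℝ) (hz : z ∈ bin01) (hd1 : d1 ∈ bin01) (hd0 : d0 ∈ bin01)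
      (hy1 : y1 ∈ bin01) (hy0 : y0 ∈ bin01) (y : ℝ) (hyb : y ∈ bin01)
      (hy : y = z * y1 + (1 - z) * y0) :
      μ.real ({ω | Z ω = z} ∩ S d1 d0 ∩ {ω | Y' ω = 1} ∩ {ω | Y1 ω = y1} ∩ {ω | Y0 ω = y0})
        = cpr μ {ω | Y ω = y} {ω | Y' ω = 1} *
          μ.real ({ω | Z ω = z} ∩ S d1 d0 ∩ {ω | Y1 ω = y1} ∩ {ω | Y0 ω = y0}) := by
    have hnd := h_ndY y hyb 1 one_mem z hz d1 hd1 d0 hd0 y1 hy1 y0 hy0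
    set C := {ω | Y ω = y} ∩ {ω | Z ω = z} ∩ {ω | D1 ω = d1} ∩ {ω | D0 ω = d0} ∩
      {ω | Y1 ω = y1} ∩ {ω | Y0 ω = y0} with hC
    have hCm : MeasurableSet C :=
      (((((level h_meas_Y y).inter (level h_meas_Z z)).inter (level h_meas_D1 d1)).inter
        (level h_meas_D0 d0)).inter (level h_meas_Y1 y1)).inter (level h_meas_Y0 y0)
    have e1 : {ω | Z ω = z} ∩ S d1 d0 ∩ {ω | Y1 ω = y1} ∩ {ω | Y0 ω = y0} = C := by
      ext ω
      simp only [hC, hS, Set.mem_inter_iff, Set.mem_ofPred_eq]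
      constructor
      · rintro ⟨⟨⟨h1, h2, h3⟩, h4⟩, h5⟩
        have : Y ω = y := by rw [h_consY, h1, h4, h5, hy]
        tauto
      · tauto
    have e2 : {ω | Z ω = z} ∩ S d1 d0 ∩ {ω | Y' ω = 1} ∩ {ω | Y1 ω = y1} ∩ {ω | Y0 ω = y0}
        = C ∩ {ω | Y' ω = 1} := by
      rw [← e1]
      ext ω
      simp only [Set.mem_inter_iff]
      tauto
    rw [e1, e2]
    by_cases h0 : μ C = 0
    · have : μ (C ∩ {ω | Y' ω = 1}) = 0 := measure_mono_null Set.inter_subset_left h0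
      simp [measureReal_def, h0, this]
    · have hpos : μ.real C ≠ 0 := by simpa [measureReal_eq_zero_iff] using h0
      rw [← hnd h0, cpr_eq_div μ hCm, div_mul_cancel₀ _ hpos]
  have indep (z : ℝ) {T : Set (ℝ × ℝ × ℝ × ℝ)} (hT : MeasurableSet T) :
      μ.real ({ω | Z ω = z} ∩ (fun ω => (Y1 ω, Y0 ω, D1 ω, D0 ω)) ⁻¹' T)
        = μ.real {ω | Z ω = z} * μ.real ((fun ω => (Y1 ω, Y0 ω, D1 ω, D0 ω)) ⁻¹' T) := by
    have := h_indep.measure_inter_preimage_eq_mul {z} T (measurableSet_singleton z) hT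
    simp only [measureReal_def, ← ENNReal.toReal_mul]
    exact congrArg ENNReal.toReal this
  have indepS (z d1 d0 : ℝ) :
      μ.real ({ω | Z ω = z} ∩ S d1 d0) = μ.real {ω | Z ω = z} * μ.real (S d1 d0) :=
    indep z (T := {p | p.2.2.1 = d1 ∧ p.2.2.2 = d0})
      ((measurableSet_eq_fun (by fun_prop) (by fun_prop)).inter
        (measurableSet_eq_fun (by fun_prop) (by fun_prop)))
  have indepS1 (z d1 d0 y : ℝ) :
      μ.real ({ω | Z ω = z} ∩ S d1 d0 ∩ {ω | Y1 ω = y})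
        = μ.real {ω | Z ω = z} * μ.real (S d1 d0 ∩ {ω | Y1 ω = y}) := by
    rw [Set.inter_assoc]
    exact indep z (T := {p | (p.2.2.1 = d1 ∧ p.2.2.2 = d0) ∧ p.1 = y})
      (((measurableSet_eq_fun (by fun_prop) (by fun_prop)).inter
        (measurableSet_eq_fun (by fun_prop) (by fun_prop))).inter
        (measurableSet_eq_fun (by fun_prop) (by fun_prop)))
  have indepS0 (z d1 d0 y : ℝ) :
      μ.real ({ω | Z ω = z} ∩ S d1 d0 ∩ {ω | Y0 ω = y})
        = μ.real {ω | Z ω = z} * μ.real (S d1 d0 ∩ {ω | Y0 ω = y}) := by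
    rw [Set.inter_assoc]
    exact indep z (T := {p | (p.2.2.1 = d1 ∧ p.2.2.2 = d0) ∧ p.2.1 = y})
      (((measurableSet_eq_fun (by fun_prop) (by fun_prop)).inter
        (measurableSet_eq_fun (by fun_prop) (by fun_prop))).inter
        (measurableSet_eq_fun (by fun_prop) (by fun_prop)))
  have treated (d1 d0 : ℝ) (hd1 : d1 ∈ bin01) (hd0 : d0 ∈ bin01) :
      μ.real ({ω | Z ω = 1} ∩ S d1 d0 ∩ {ω | Y' ω = 1}) = μ.real {ω | Z ω = 1} *
        ((1 - SPY) * μ.real (S d1 d0) + (SNY + SPY - 1) * μ.real (S d1 d0 ∩ {ω | Y1 ω = 1})) := by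
    rw [split h_meas_Y1 h_bin_Y1 ({ω | Z ω = 1} ∩ S d1 d0 ∩ {ω | Y' ω = 1}),
      split h_meas_Y0 h_bin_Y0 (_ ∩ {ω | Y1 ω = 0}), split h_meas_Y0 h_bin_Y0 (_ ∩ {ω | Y1 ω = 1}),
      cell 1 d1 d0 0 0 one_mem hd1 hd0 zero_mem zero_mem 0 zero_mem (by norm_num),
      cell 1 d1 d0 0 1 one_mem hd1 hd0 zero_mem one_mem 0 zero_mem (by norm_num),
      cell 1 d1 d0 1 0 one_mem hd1 hd0 one_mem zero_mem 1 one_mem (by norm_num),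
      cell 1 d1 d0 1 1 one_mem hd1 hd0 one_mem one_mem 1 one_mem (by norm_num),
      hq0, ← h_SNY, ← mul_add, ← mul_add, ← split h_meas_Y0 h_bin_Y0, ← split h_meas_Y0 h_bin_Y0,
      indepS1, indepS1, split h_meas_Y1 h_bin_Y1 (S d1 d0)]
    ring
  have untreated (d1 d0 : ℝ) (hd1 : d1 ∈ bin01) (hd0 : d0 ∈ bin01) :
      μ.real ({ω | Z ω = 0} ∩ S d1 d0 ∩ {ω | Y' ω = 1}) = μ.real {ω | Z ω = 0} *
        ((1 - SPY) * μ.real (S d1 d0) + (SNY + SPY - 1) * μ.real (S d1 d0 ∩ {ω | Y0 ω = 1})) := by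
    rw [split h_meas_Y0 h_bin_Y0 ({ω | Z ω = 0} ∩ S d1 d0 ∩ {ω | Y' ω = 1}),
      split h_meas_Y1 h_bin_Y1 (_ ∩ {ω | Y0 ω = 0}), split h_meas_Y1 h_bin_Y1 (_ ∩ {ω | Y0 ω = 1}),
      Set.inter_right_comm _ {ω | Y0 ω = 0} {ω | Y1 ω = 0},
      Set.inter_right_comm _ {ω | Y0 ω = 0} {ω | Y1 ω = 1},
      Set.inter_right_comm _ {ω | Y0 ω = 1} {ω | Y1 ω = 0},
      Set.inter_right_comm _ {ω | Y0 ω = 1} {ω | Y1 ω = 1},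
      cell 0 d1 d0 0 0 zero_mem hd1 hd0 zero_mem zero_mem 0 zero_mem (by norm_num),
      cell 0 d1 d0 0 1 zero_mem hd1 hd0 zero_mem one_mem 1 one_mem (by norm_num),
      cell 0 d1 d0 1 0 zero_mem hd1 hd0 one_mem zero_mem 0 zero_mem (by norm_num),
      cell 0 d1 d0 1 1 zero_mem hd1 hd0 one_mem one_mem 1 one_mem (by norm_num),
      Set.inter_right_comm _ {ω | Y1 ω = 0} {ω | Y0 ω = 0},
      Set.inter_right_comm _ {ω | Y1 ω = 0} {ω | Y0 ω = 1},
      Set.inter_right_comm _ {ω | Y1 ω = 1} {ω | Y0 ω = 0},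
      Set.inter_right_comm _ {ω | Y1 ω = 1} {ω | Y0 ω = 1},
      hq0, ← h_SNY, ← mul_add, ← mul_add, ← split h_meas_Y1 h_bin_Y1, ← split h_meas_Y1 h_bin_Y1,
      indepS0, indepS0, split h_meas_Y0 h_bin_Y0 (S d1 d0)]
    ring
  have no_defiers : μ.real (S 0 1) = 0 := by
    rw [measureReal_eq_zero_iff]
    refine measure_mono_null ?_ (ae_iff.mp h_mono)
    rintro ω ⟨h1, h0⟩
    simp [h1, h0]
  have no_defiers_inter (A : Set Ω) : μ.real (S 0 1 ∩ A) = 0 :=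
    le_antisymm ((measureReal_mono Set.inter_subset_left).trans no_defiers.le) measureReal_nonneg
  have splitZ1 (d : ℝ) (A : Set Ω) : μ.real ({ω | Z ω = 1} ∩ {ω | D ω = d} ∩ A)
      = μ.real ({ω | Z ω = 1} ∩ S d 0 ∩ A) + μ.real ({ω | Z ω = 1} ∩ S d 1 ∩ A) := by
    rw [split h_meas_D0 h_bin_D0]
    congr 2 <;>
    · ext ω
      by_cases h : Z ω = 1
      · simp only [hS, Set.mem_inter_iff, Set.mem_ofPred_eq, h_consD, h, one_mul, zero_mul,
          sub_self, add_zero]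
        tauto
      · simp [h]
  have splitZ0 (d : ℝ) (A : Set Ω) : μ.real ({ω | Z ω = 0} ∩ {ω | D ω = d} ∩ A)
      = μ.real ({ω | Z ω = 0} ∩ S 0 d ∩ A) + μ.real ({ω | Z ω = 0} ∩ S 1 d ∩ A) := by
    rw [split h_meas_D1 h_bin_D1]
    congr 2 <;>
    · ext ω
      by_cases h : Z ω = 0
      · simp only [hS, Set.mem_inter_iff, Set.mem_ofPred_eq, h_consD, h, one_mul, zero_mul,
          sub_zero, zero_add]
        tauto
      · simp [h]
  have splitZ1' (d : ℝ) : μ.real ({ω | Z ω = 1} ∩ {ω | D ω = d})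
      = μ.real {ω | Z ω = 1} * (μ.real (S d 0) + μ.real (S d 1)) := by
    simpa [indepS, mul_add] using splitZ1 d Set.univ
  have splitZ0' (d : ℝ) : μ.real ({ω | Z ω = 0} ∩ {ω | D ω = d})
      = μ.real {ω | Z ω = 0} * (μ.real (S 0 d) + μ.real (S 1 d)) := by
    simpa [indepS, mul_add] using splitZ0 d Set.univ
  have hZ (z : ℝ) (hz : z ∈ bin01) : μ.real {ω | Z ω = z} ≠ 0 := by
    rw [Ne, measureReal_eq_zero_iff]
    exact fun h => h_posDZ 0 zero_mem z hz (measure_mono_null Set.inter_subset_right h)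
  have hZ1 := hZ 1 one_mem
  have hZ0 := hZ 0 zero_mem
  have ha : μ.real (S 1 1) ≠ 0 := h_Ua.ne'
  have hn : μ.real (S 0 0) ≠ 0 := h_Un.ne'
  have hc : μ.real (S 1 0) ≠ 0 := h_Uc.ne'
  have hRDD : RDD = μ.real (S 1 0) := by
    rw [h_RDD, cpr_eq_div μ (level h_meas_Z 1), cpr_eq_div μ (level h_meas_Z 0), splitZ1', splitZ0',
      no_defiers]
    field_simp
    ring
  have never : cpr μ (S 0 0) {ω | Y1 ω = 1}
      = (cpr μ ({ω | D ω = 0} ∩ {ω | Z ω = 1}) {ω | Y' ω = 1} - (1 - SPY)) / (SNY + SPY - 1) := by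
    rw [cpr_eq_div μ (stratum_measurable 0 0),
      cpr_eq_div μ ((level h_meas_D 0).inter (level h_meas_Z 1)),
      Set.inter_comm {ω | D ω = 0}, splitZ1, splitZ1', treated 0 0 zero_mem zero_mem,
      treated 0 1 zero_mem one_mem, no_defiers, no_defiers_inter]
    field_simp
    ring
  have always : cpr μ (S 1 1) {ω | Y0 ω = 1}
      = (cpr μ ({ω | D ω = 1} ∩ {ω | Z ω = 0}) {ω | Y' ω = 1} - (1 - SPY)) / (SNY + SPY - 1) := by
    rw [cpr_eq_div μ (stratum_measurable 1 1),
      cpr_eq_div μ ((level h_meas_D 1).inter (level h_meas_Z 0)),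
      Set.inter_comm {ω | D ω = 1}, splitZ0, splitZ0', untreated 0 1 zero_mem one_mem,
      untreated 1 1 one_mem one_mem, no_defiers, no_defiers_inter]
    field_simp
    ring
  have exclusion (d1 d0 : ℝ) (h : cpr μ (S d1 d0) {ω | Y1 ω = 1} = cpr μ (S d1 d0) {ω | Y0 ω = 1})
      (hpos : μ.real (S d1 d0) ≠ 0) :
      μ.real (S d1 d0 ∩ {ω | Y1 ω = 1}) = μ.real (S d1 d0 ∩ {ω | Y0 ω = 1}) := by
    rwa [cpr_eq_div μ (stratum_measurable d1 d0), cpr_eq_div μ (stratum_measurable d1 d0),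
      div_left_inj' hpos] at h
  have exclA := exclusion 1 1 h_exclA ha
  have exclN := exclusion 0 0 h_exclN hn
  have swap (z d : ℝ) : {ω | Z ω = z} ∩ ({ω | Y' ω = 1} ∩ {ω | D ω = d})
      = {ω | Z ω = z} ∩ {ω | D ω = d} ∩ {ω | Y' ω = 1} := by
    rw [Set.inter_assoc, Set.inter_comm {ω | Y' ω = 1}]
  refine ⟨never, h_exclN.symm.trans never, h_exclA.trans always, always, ?_, ?_⟩
  · rw [cpr_eq_div μ (stratum_measurable 1 0), cpr_eq_div μ (level h_meas_Z 1),
      cpr_eq_div μ (level h_meas_Z 0), swap, swap, splitZ1, splitZ0,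
      treated 1 0 one_mem zero_mem, treated 1 1 one_mem one_mem,
      untreated 0 1 zero_mem one_mem, untreated 1 1 one_mem one_mem,
      no_defiers, no_defiers_inter, exclA, hRDD]
    field_simp
    ring
  · rw [cpr_eq_div μ (stratum_measurable 1 0), cpr_eq_div μ (level h_meas_Z 1),
      cpr_eq_div μ (level h_meas_Z 0), swap, swap, splitZ1, splitZ0,
      treated 0 0 zero_mem zero_mem, treated 0 1 zero_mem one_mem,
      untreated 0 0 zero_mem zero_mem, untreated 1 0 one_mem zero_mem,
      no_defiers, no_defiers_inter, exclN, hRDD]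
    field_simp
    ring
end
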